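/- arXiv:2305.19951 — 4 statements merged into one kernel-verified Lean document; each statement's English description precedes it below -/
import Mathlib

section
/- Let G, S, Y be finite types and X any type. Let pG be a pmf on G and pS a pmf on S, let f : G × S → X be any function (the deterministic data-generating map of assumption A1), let pY : G → (Y → ℝ) assign to each g a pmf on Y (the ground-truth label distribution), and let q : X → (Y → ℝ) satisfy 0 < q x y ≤ 1 for all x, y (the predictor's label probabilities). Define the abstracted predictor q̄ g y := ∑_{s} pS s * q (f (g,s)) y. Then the expected log-likelihood is upper bounded as: ∑_g pG g * ∑_s pS s * ∑_y pY g y * log (q (f (g,s)) y) ≤ ∑_g pG g * ( −(∑_y pY g y * log (pY g y / q̄ g y)) − (−∑_y pY g y * log (pY g y)) ), i.e., it is at most the expectation over g ~ pG of minus the Kullback–Leibler divergence KL(pY g ‖ q̄ g) minus the Shannon entropy H(pY g), where log denotes the real logarithm (with the convention log 0 = 0). -/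
/-- Lemma 3.1(i), discrete form: the expected log-likelihood is upper bounded by the
expectation over `g ~ pG` of minus the KL divergence from `pY g` to the abstracted
predictor `q̄ g`, minus the Shannon entropy of `pY g`. -/
theorem loglik_le_neg_kl_sub_entropy
    {G S Y : Type*} {X : Type*} [Fintype G] [Fintype S] [Fintype Y]
    (pG : G → ℝ) (hpG_nonneg : ∀ g, 0 ≤ pG g) (hpG_sum : ∑ g, pG g = 1)
    (pS : S → ℝ) (hpS_nonneg : ∀ s, 0 ≤ pS s) (hpS_sum : ∑ s, pS s = 1)
    (f : G × S → X)
    (pY : G → Y → ℝ) (hpY_nonneg : ∀ g y, 0 ≤ pY g y) (hpY_sum : ∀ g, ∑ y, pY g y = 1)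
    (q : X → Y → ℝ) (hq_pos : ∀ x y, 0 < q x y) (hq_le : ∀ x y, q x y ≤ 1) :
    ∑ g, pG g * ∑ s, pS s * ∑ y, pY g y * Real.log (q (f (g, s)) y) ≤
      ∑ g, pG g *
        (-(∑ y, pY g y * Real.log (pY g y / (∑ s, pS s * q (f (g, s)) y)))
          - (-∑ y, pY g y * Real.log (pY g y))) := by
  refine Finset.sum_le_sum fun g _ => mul_le_mul_of_nonneg_left ?_ (hpG_nonneg g)
  have hpos : ∀ y, 0 < ∑ s, pS s * q (f (g, s)) y := by
    intro y
    obtain ⟨s, _, hs⟩ : ∃ s ∈ Finset.univ, 0 < pS s := by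
      by_contra! h
      have := Finset.sum_nonpos h
      linarith
    exact Finset.sum_pos' (fun s _ => mul_nonneg (hpS_nonneg s) (hq_pos _ _).le)
      ⟨s, Finset.mem_univ s, mul_pos hs (hq_pos _ _)⟩
  have hJ : ∀ y, ∑ s, pS s * Real.log (q (f (g, s)) y)
      ≤ Real.log (∑ s, pS s * q (f (g, s)) y) := by
    intro y
    have h := strictConcaveOn_log_Ioi.concaveOn.le_map_sum (t := Finset.univ) (w := pS)
      (p := fun s => q (f (g, s)) y) (fun s _ => hpS_nonneg s) hpS_sum
      (fun s _ => hq_pos _ _)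
    simpa only [smul_eq_mul] using h
  have hL : ∑ s, pS s * ∑ y, pY g y * Real.log (q (f (g, s)) y)
      = ∑ y, pY g y * ∑ s, pS s * Real.log (q (f (g, s)) y) := by
    simp only [Finset.mul_sum]
    rw [Finset.sum_comm]
    exact Finset.sum_congr rfl fun y _ => Finset.sum_congr rfl fun s _ => by ring
  have hR : -(∑ y, pY g y * Real.log (pY g y / (∑ s, pS s * q (f (g, s)) y)))
      - (-∑ y, pY g y * Real.log (pY g y))
      = ∑ y, pY g y * Real.log (∑ s, pS s * q (f (g, s)) y) := by
    rw [← Finset.sum_neg_distrib, ← Finset.sum_neg_distrib, ← Finset.sum_sub_distrib]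
    refine Finset.sum_congr rfl fun y _ => ?_
    rcases eq_or_ne (pY g y) 0 with h | h
    · simp [h]
    · rw [Real.log_div h (hpos y).ne']
      ring
  rw [hL, hR]
  exact Finset.sum_le_sum fun y _ => mul_le_mul_of_nonneg_left (hJ y) (hpY_nonneg g y)
end

section
/- Let G be a finite type, T : ℕ, and for each t : Fin T let Y t be a finite type and β t : G → Y t a function (the label map of task t). Define the joint map B : G → (∀ t, Y t) by B g t := β t g. Then: (1) a map α : G → G satisfies β t (α g) = β t g for all g : G and all t : Fin T if and only if it satisfies B (α g) = B g for all g : G; and (2) the number of such maps α equals ∏_{v : ∀ t, Y t} m_v ^ m_v, where m_v is the cardinality of the joint fiber {g : G | B g = v} (with the convention 0^0 = 1). -/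
/-- Proposition 4.1 with explicit count: a map `α` is consistent with all `T` tasks iff
it is consistent with the single task given by the joint label map `B g = fun t => β t g`,
and the number of such maps is `∏ v, m_v ^ m_v` over the joint fibers. -/
theorem multitask_optima_eq_conjunction_optima
    {G : Type*} [Fintype G] [DecidableEq G]
    (T : ℕ) (Y : Fin T → Type*) [∀ t, Fintype (Y t)] [∀ t, DecidableEq (Y t)]
    (β : ∀ t, G → Y t) :
    (∀ α : G → G,
      (∀ g, ∀ t, β t (α g) = β t g) ↔ (∀ g, (fun t => β t (α g)) = (fun t => β t g))) ∧
    Nat.card {α : G → G // ∀ g, ∀ t, β t (α g) = β t g} =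
      ∏ v : (∀ t, Y t),
        (Finset.univ.filter (fun g => (fun t => β t g) = v)).card ^
          (Finset.univ.filter (fun g => (fun t => β t g) = v)).card := by
  refine ⟨fun α => by simp only [funext_iff], ?_⟩
  have e : {α : G → G // ∀ g, ∀ t, β t (α g) = β t g} ≃
      ((g : G) → {h : G // (fun t => β t h) = (fun t => β t g)}) :=
    { toFun := fun α g => ⟨α.1 g, funext (α.2 g)⟩
      invFun := fun f => ⟨fun g => (f g).1, fun g t => congrFun (f g).2 t⟩
      left_inv := fun _ => rfl
      right_inv := fun _ => rfl }
  rw [Nat.card_congr e, Nat.card_pi,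
    ← Finset.prod_fiberwise (s := Finset.univ) (g := fun (g : G) => (fun t => β t g))]
  refine Finset.prod_congr rfl fun v _ => ?_
  refine Finset.prod_eq_pow_card fun g hg => ?_
  have hv := (Finset.mem_filter.mp hg).2
  rw [hv, Nat.card_eq_fintype_card, Fintype.card_subtype]
end

section
/- Let G and Y be finite types, β : G → Y any function, and S a finite subset of G (the set of examples with full concept supervision). Then the number of maps α : G → G satisfying both (a) β (α g) = β g for every g : G and (b) α g = g for every g ∈ S, equals ∏_{y : Y} n_y ^ k_y, where n_y is the cardinality of the fiber {g : G | β g = y} and k_y is the cardinality of {g : G | β g = y} \ S (with the convention 0^0 = 1). -/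
/-- Proposition 4.3 combined with Theorem 3.2 (full concept supervision on `S`): the
number of fiber-preserving maps fixing `S` pointwise equals `∏ y, n_y ^ k_y`, where
`n_y` is the fiber cardinality and `k_y` the cardinality of the unsupervised part of the
fiber. -/
theorem card_fiber_preserving_maps_fixing_supervised
    {G Y : Type*} [Fintype G] [Fintype Y] [DecidableEq G] [DecidableEq Y]
    (β : G → Y) (S : Finset G) :
    Nat.card {α : G → G // (∀ g, β (α g) = β g) ∧ ∀ g ∈ S, α g = g} =
      ∏ y : Y, (Finset.univ.filter (fun g => β g = y)).card ^
        ((Finset.univ.filter (fun g => β g = y)) \ S).card := by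
  have h1 : Nat.card {α : G → G // (∀ g, β (α g) = β g) ∧ ∀ g ∈ S, α g = g} =
      (Fintype.piFinset (fun g : G => if g ∈ S then ({g} : Finset G)
        else Finset.univ.filter (fun x => β x = β g))).card := by
    rw [← Nat.card_eq_finsetCard]
    refine Nat.card_congr (Equiv.subtypeEquivRight fun α => ?_)
    rw [Fintype.mem_piFinset]
    constructor
    · rintro ⟨ha, hb⟩ g
      by_cases h : g ∈ S
      · simp [h, hb g h]
      · simp [h, ha g]
    · intro H
      refine ⟨fun g => ?_, fun g hg => ?_⟩
      · have := H g
        by_cases h : g ∈ S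
        · simp only [h, if_true, Finset.mem_singleton] at this
          rw [this]
        · simpa [h] using this
      · simpa [hg] using H g
  rw [h1, Fintype.card_piFinset, ← Finset.prod_fiberwise (s := Finset.univ) (g := β)]
  refine Finset.prod_congr rfl fun y _ => ?_
  rw [← Finset.prod_const, Finset.sdiff_eq_filter, Finset.prod_filter (fun x => x ∉ S)]
  refine Finset.prod_congr rfl fun g hg => ?_
  have hy : β g = y := (Finset.mem_filter.mp hg).2
  by_cases h : g ∈ S <;> simp [h, hy]
end

section
/- Let G and Y be finite types, β : G → Y any function, and S a finite subset of G. Then the number of maps α : G → G that are injective, satisfy β (α g) = β g for every g : G, and satisfy α g = g for every g ∈ S, equals ∏_{y : Y} (k_y)!, where k_y is the cardinality of the set {g : G | β g = y} \ S. -/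
/-- Appendix B.2, likelihood + reconstruction + concept supervision: the number of
injective fiber-preserving maps fixing `S` pointwise equals `∏ y, (k_y)!`, where `k_y`
is the cardinality of the unsupervised part of the fiber over `y`. -/
theorem card_injective_fiber_preserving_maps_fixing_supervised
    {G Y : Type*} [Fintype G] [Fintype Y] [DecidableEq G] [DecidableEq Y]
    (β : G → Y) (S : Finset G) :
    Nat.card
        {α : G → G //
          Function.Injective α ∧ (∀ g, β (α g) = β g) ∧ ∀ g ∈ S, α g = g} =
      ∏ y : Y, Nat.factorial ((Finset.univ.filter (fun g => β g = y)) \ S).card := by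
  have key := DomMulAct.stabilizer_card (fun a : {a : G // a ∉ S} => β a.1)
  have hprod : ∀ y : Y, Fintype.card {a : {a : G // a ∉ S} // β a.1 = y} =
      ((Finset.univ.filter (fun g => β g = y)) \ S).card := by
    intro y
    rw [← Fintype.card_coe]
    refine Fintype.card_congr ((Equiv.subtypeSubtypeEquivSubtypeInter
      (fun a : G => a ∉ S) (fun a => β a = y)).trans (Equiv.subtypeEquivRight ?_))
    intro a
    simp [and_comm]
  simp only [hprod] at key
  rw [← key, ← Nat.card_eq_fintype_card]
  symm
  let F : {g : Equiv.Perm {a : G // a ∉ S} // (fun a : {a : G // a ∉ S} => β a.1) ∘ g =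
      (fun a : {a : G // a ∉ S} => β a.1)} → {α : G → G //
          Function.Injective α ∧ (∀ g, β (α g) = β g) ∧ ∀ g ∈ S, α g = g} := fun g =>
    ⟨Equiv.Perm.ofSubtype g.1, Equiv.injective _, by
      intro a
      by_cases h : a ∉ S
      · rw [Equiv.Perm.ofSubtype_apply_of_mem (p := fun a : G => a ∉ S) _ h]
        exact congrFun g.2 ⟨a, h⟩
      · rw [Equiv.Perm.ofSubtype_apply_of_not_mem (p := fun a : G => a ∉ S) _ h], by
      intro a h
      exact Equiv.Perm.ofSubtype_apply_of_not_mem _ (not_not.2 h)⟩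
  refine Nat.card_eq_of_bijective F ⟨?_, ?_⟩
  · intro g h hgh
    apply Subtype.ext
    apply Equiv.Perm.ofSubtype_injective
    exact DFunLike.coe_injective (congrArg Subtype.val hgh)
  · rintro ⟨α, hi, hb, hs⟩
    let e : Equiv.Perm G := Equiv.ofBijective α (Finite.injective_iff_bijective.1 hi)
    have he : ∀ a, e a = α a := fun a => rfl
    obtain ⟨p, hp⟩ := (Equiv.Perm.subtypeEquivSubtypePerm (fun a : G => a ∉ S)).surjective
      ⟨e, fun a h => hs a (not_not.1 h)⟩
    have hp' : Equiv.Perm.ofSubtype p = e := congrArg Subtype.val hp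
    refine ⟨⟨p, ?_⟩, ?_⟩
    · funext a
      have := hb a.1
      rw [← he, ← hp', Equiv.Perm.ofSubtype_apply_of_mem p a.2] at this
      exact this
    · apply Subtype.ext
      funext a
      change Equiv.Perm.ofSubtype p a = α a
      rw [hp', he]
end
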